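/- For every real σ > 0 and every real t with σ + it ≠ 1, one has ∫_{-∞}^∞ e^{itx} V_σ(x) dx = (1 - 2^{1-(σ+it)})·Γ(σ+it)·ζ(σ+it); that is, up to the factor √(2π), the Fourier transform of V_σ evaluated at -t equals (1 - 2^{1-z})Γ(z)ζ(z) at z = σ + it. -/

import Mathlib

open Complex MeasureTheory

lemma aux_two_pow {s : ℂ} (n : ℕ) : ((2 * n : ℕ) : ℂ) ^ s = 2 ^ s * (n : ℂ) ^ s := by
  push_cast
  have := Complex.mul_cpow_ofReal_nonneg (a := 2) (b := n) (by norm_num) (by positivity) s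
  simpa using this

lemma aux_char (n : ℕ) : cexp (2 * Real.pi * I * ((1 / 2 : ℝ) : ℂ) * n) = (-1) ^ n := by
  rw [← Complex.exp_pi_mul_I, ← Complex.exp_nat_mul]
  congr 1
  push_cast
  ring

lemma aux_expZeta_hasSum {s : ℂ} (hs : 1 < s.re) :
    HasSum (fun n : ℕ => (-1 : ℂ) ^ n / (n : ℂ) ^ s)
      (HurwitzZeta.expZeta ((1 / 2 : ℝ) : UnitAddCircle) s) := by
  have := HurwitzZeta.hasSum_expZeta_of_one_lt_re (1 / 2) hs
  refine this.congr_fun fun n => ?_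
  rw [← aux_char]

lemma aux_half_ne : (((1 / 2 : ℝ) : UnitAddCircle)) ≠ 0 := by
  intro h
  rw [AddCircle.coe_eq_zero_iff] at h
  obtain ⟨n, hn⟩ := h
  have h2 : (2 * n : ℝ) = 1 := by
    simp only [zsmul_eq_mul, mul_one] at hn
    linarith
  have h3 : 2 * n = 1 := by exact_mod_cast h2
  omega

lemma aux_halfplane (c : ℝ) : IsOpen {s : ℂ | c < s.re} :=
  isOpen_lt continuous_const Complex.continuous_re

lemma aux_expZeta_eq_of_one_lt {s : ℂ} (hs : 1 < s.re) :
    HurwitzZeta.expZeta ((1 / 2 : ℝ) : UnitAddCircle) s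
      = -((1 - (2 : ℂ) ^ (1 - s)) * riemannZeta s) := by
  have hE := aux_expZeta_hasSum hs
  have hZ : HasSum (fun n : ℕ => 1 / (n : ℂ) ^ s) (riemannZeta s) := by
    rw [zeta_eq_tsum_one_div_nat_cpow hs]
    exact (Complex.summable_one_div_nat_cpow.mpr hs).hasSum
  have hA := hE.add hZ
  have hev : HasSum (fun n : ℕ => (-1 : ℂ) ^ (2 * n) / ((2 * n : ℕ) : ℂ) ^ s
      + 1 / ((2 * n : ℕ) : ℂ) ^ s) (2 / 2 ^ s * riemannZeta s) := by
    refine (hZ.mul_left (2 / 2 ^ s)).congr_fun fun n => ?_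
    rw [aux_two_pow, pow_mul]
    ring
  have hodd : HasSum (fun n : ℕ => (-1 : ℂ) ^ (2 * n + 1) / ((2 * n + 1 : ℕ) : ℂ) ^ s
      + 1 / ((2 * n + 1 : ℕ) : ℂ) ^ s) 0 := by
    refine hasSum_zero.congr_fun fun n => ?_
    rw [pow_succ, pow_mul]
    ring
  have hB := HasSum.even_add_odd
    (f := fun n : ℕ => (-1 : ℂ) ^ n / (n : ℂ) ^ s + 1 / (n : ℂ) ^ s) hev hodd
  have := hA.unique hB
  rw [Complex.cpow_sub _ _ two_ne_zero, cpow_one]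
  linear_combination this

lemma aux_expZeta_eq {s : ℂ} (hs : s ≠ 1) :
    HurwitzZeta.expZeta ((1 / 2 : ℝ) : UnitAddCircle) s
      = -((1 - (2 : ℂ) ^ (1 - s)) * riemannZeta s) := by
  have hf : AnalyticOnNhd ℂ (HurwitzZeta.expZeta ((1 / 2 : ℝ) : UnitAddCircle)) {1}ᶜ :=
    (HurwitzZeta.differentiable_expZeta_of_ne_zero aux_half_ne).differentiableOn.analyticOnNhd
      isOpen_compl_singleton
  have hg : AnalyticOnNhd ℂ (fun s => -((1 - (2 : ℂ) ^ (1 - s)) * riemannZeta s)) {1}ᶜ := by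
    refine DifferentiableOn.analyticOnNhd (fun z hz => ?_) isOpen_compl_singleton
    refine DifferentiableAt.differentiableWithinAt ?_
    have h1 := differentiableAt_riemannZeta hz
    have h2 : DifferentiableAt ℂ (fun s : ℂ => (2 : ℂ) ^ (1 - s)) z :=
      DifferentiableAt.const_cpow (by fun_prop) (Or.inl two_ne_zero)
    fun_prop
  refine hf.eqOn_of_preconnected_of_eventuallyEq hg
    (isConnected_compl_singleton_of_one_lt_rank (by simp) 1).isPreconnected
    (z₀ := 2) (by simp) ?_ hs
  filter_upwards [(aux_halfplane 1).mem_nhds (show (2 : ℂ) ∈ _ by simp)] with z hz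
  exact aux_expZeta_eq_of_one_lt hz

/-- The Fermi function, complex-valued. -/
noncomputable def auxF (t : ℝ) : ℂ := ((1 / (1 + Real.exp t) : ℝ) : ℂ)

lemma aux_geom {t : ℝ} (ht : 0 < t) :
    HasSum (fun n : ℕ => (if n = 0 then (0 : ℂ) else -(-1) ^ n) * Real.exp (-(n : ℝ) * t))
      (auxF t) := by
  have hq : ‖-((Real.exp (-t) : ℝ) : ℂ)‖ < 1 := by
    rw [norm_neg, Complex.norm_real, Real.norm_eq_abs, Real.abs_exp]
    simpa using ht
  have h1 := hasSum_geometric_of_norm_lt_one hq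
  have h2 := (hasSum_ite_eq (0 : ℕ) (1 : ℂ)).sub h1
  have h3 : (1 : ℂ) - (1 - -((Real.exp (-t) : ℝ) : ℂ))⁻¹ = auxF t := by
    have hr : (1 : ℝ) - (1 - -(Real.exp (-t)))⁻¹ = 1 / (1 + Real.exp t) := by
      rw [Real.exp_neg, sub_neg_eq_add]
      have := Real.exp_pos t
      have h0 : 1 + (Real.exp t)⁻¹ ≠ 0 := by positivity
      have h4 : 1 + Real.exp t ≠ 0 := by positivity
      have h5 : (1 + (Real.exp t)⁻¹)⁻¹ = Real.exp t / (1 + Real.exp t) := by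
        rw [inv_eq_iff_eq_inv, inv_div]
        field_simp
        ring
      rw [h5]
      field_simp
      ring
    unfold auxF
    rw [← hr]
    push_cast
    rfl
  rw [h3] at h2
  refine h2.congr_fun fun n => ?_
  rcases eq_or_ne n 0 with rfl | hn
  · simp
  · have : Real.exp (-(n : ℝ) * t) = Real.exp (-t) ^ n := by
      rw [← Real.exp_nat_mul]; congr 1; ring
    rw [this]
    simp only [hn, if_false]
    rw [neg_pow ((Real.exp (-t) : ℝ) : ℂ)]
    push_cast
    ring

lemma aux_mellin_of_one_lt {s : ℂ} (hs : 1 < s.re) :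
    mellin auxF s
      = -(Complex.Gamma s * HurwitzZeta.expZeta ((1 / 2 : ℝ) : UnitAddCircle) s) := by
  have h := hasSum_mellin (a := fun n : ℕ => if n = 0 then (0 : ℂ) else -(-1) ^ n)
    (p := fun n : ℕ => (n : ℝ)) (F := auxF) (s := s)
    (fun n => by
      rcases eq_or_ne n 0 with rfl | hn
      · simp
      · right; positivity)
    (by linarith) (fun t ht => aux_geom ht)
    (by
      refine Summable.of_nonneg_of_le (fun n => by positivity) (fun n => ?_)
        (Real.summable_one_div_nat_rpow.mpr hs)
      gcongr
      split_ifs <;> simp)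
  have h2 := ((aux_expZeta_hasSum hs).mul_left (Complex.Gamma s)).neg
  refine h.unique (h2.congr_fun fun n => ?_)
  rcases eq_or_ne n 0 with rfl | hn
  · have : s ≠ 0 := Complex.ne_zero_of_one_lt_re hs
    simp [this]
  · simp only [hn, if_false, ofReal_natCast]
    ring

lemma auxF_cont : Continuous auxF := by
  unfold auxF
  refine Complex.continuous_ofReal.comp ?_
  refine Continuous.div (by fun_prop) (by fun_prop) fun x => ?_
  positivity

lemma auxF_norm (t : ℝ) : ‖auxF t‖ = 1 / (1 + Real.exp t) := by
  rw [auxF, Complex.norm_real, Real.norm_of_nonneg (by positivity)]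

lemma aux_mellin_diff {s : ℂ} (hs : 0 < s.re) : DifferentiableAt ℂ (mellin auxF) s := by
  refine mellin_differentiableAt_of_isBigO_rpow_exp (a := 1) (b := 0) one_pos
    (auxF_cont.locallyIntegrable.locallyIntegrableOn _) ?_ ?_ hs
  · refine Asymptotics.IsBigO.of_bound 1 (Filter.Eventually.of_forall fun t => ?_)
    rw [auxF_norm, Real.norm_eq_abs, Real.abs_exp, one_mul, neg_one_mul, Real.exp_neg, one_div]
    gcongr
    linarith
  · refine Asymptotics.IsBigO.of_bound 1 (Filter.Eventually.of_forall fun t => ?_)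
    rw [auxF_norm]
    simp only [neg_zero, Real.rpow_zero, norm_one, mul_one]
    rw [div_le_one (by positivity)]
    linarith [Real.exp_pos t]

lemma aux_mellin {s : ℂ} (hs : 0 < s.re) :
    mellin auxF s
      = -(Complex.Gamma s * HurwitzZeta.expZeta ((1 / 2 : ℝ) : UnitAddCircle) s) := by
  have hU := aux_halfplane 0
  have hf : AnalyticOnNhd ℂ (mellin auxF) {s : ℂ | 0 < s.re} :=
    DifferentiableOn.analyticOnNhd
      (fun z hz => (aux_mellin_diff hz).differentiableWithinAt) hU
  have hg : AnalyticOnNhd ℂ (fun s => -(Complex.Gamma s *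
      HurwitzZeta.expZeta ((1 / 2 : ℝ) : UnitAddCircle) s)) {s : ℂ | 0 < s.re} := by
    refine DifferentiableOn.analyticOnNhd (fun z hz => ?_) hU
    refine DifferentiableAt.differentiableWithinAt ?_
    have h1 := HurwitzZeta.differentiable_expZeta_of_ne_zero aux_half_ne z
    have h2 : DifferentiableAt ℂ Complex.Gamma z :=
      Complex.differentiableAt_Gamma z fun m hm => by
        have h3 : 0 < z.re := hz
        rw [hm] at h3
        simp only [neg_re, natCast_re] at h3
        have : (0 : ℝ) ≤ m := m.cast_nonneg
        linarith
    exact (h2.mul h1).neg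
  refine hf.eqOn_of_preconnected_of_eventuallyEq hg
    (convex_halfSpace_re_gt 0).isPreconnected (z₀ := 2) (by simp) ?_ hs
  filter_upwards [(aux_halfplane 1).mem_nhds (show (2 : ℂ) ∈ _ by simp)] with z hz
  exact aux_mellin_of_one_lt hz

lemma aux_integral (s : ℂ) :
    mellin auxF s = ∫ x : ℝ, cexp (s * x) * auxF (Real.exp x) := by
  rw [mellin, ← Real.range_exp, ← Set.image_univ,
    integral_image_eq_integral_abs_deriv_smul MeasurableSet.univ
      (fun x _ => (Real.hasDerivAt_exp x).hasDerivWithinAt) Real.exp_injective.injOn,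
    Measure.restrict_univ]
  congr 1
  ext x
  have h : ((Real.exp x : ℝ) : ℂ) ^ (s - 1) = cexp ((s - 1) * x) := by
    rw [Complex.cpow_def_of_ne_zero (by exact_mod_cast (Real.exp_pos x).ne'),
      ← Complex.ofReal_log (Real.exp_pos x).le, Real.log_exp, mul_comm]
  rw [h, Real.abs_exp, Complex.real_smul, smul_eq_mul, ← mul_assoc, Complex.ofReal_exp,
    ← Complex.exp_add]
  congr 2
  ring

/-- For `σ > 0`, `t ∈ ℝ` with `σ + it ≠ 1`:
`∫_ℝ e^{itx} V_σ(x) dx = (1 - 2^{1-(σ+it)}) Γ(σ+it) ζ(σ+it)`. -/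
theorem fourier_V_eq_eta_Gamma_zeta (σ t : ℝ) (hσ : 0 < σ)
    (h1 : (σ : ℂ) + t * Complex.I ≠ 1) :
    ∫ x : ℝ, Complex.exp (Complex.I * t * x)
        * ((Real.exp (σ * x) / (1 + Real.exp (Real.exp x)) : ℝ) : ℂ)
      = (1 - (2 : ℂ) ^ (1 - ((σ : ℂ) + t * Complex.I)))
          * Complex.Gamma ((σ : ℂ) + t * Complex.I)
          * riemannZeta ((σ : ℂ) + t * Complex.I) := by
  have hs : 0 < ((σ : ℂ) + t * Complex.I).re := by simpa using hσ
  have h2 := aux_mellin hs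
  rw [aux_expZeta_eq h1, aux_integral] at h2
  have h3 : ∀ x : ℝ, Complex.exp (Complex.I * t * x)
        * ((Real.exp (σ * x) / (1 + Real.exp (Real.exp x)) : ℝ) : ℂ)
      = cexp (((σ : ℂ) + t * Complex.I) * x) * auxF (Real.exp x) := by
    intro x
    rw [auxF, div_eq_mul_one_div, Complex.ofReal_mul, ← mul_assoc, Complex.ofReal_exp,
      ← Complex.exp_add]
    congr 2
    push_cast
    ring
  simp_rw [h3]
  rw [h2]
  ring
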